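/- For all real x ≥ 0, the first derivative of L(x) = log(Q(x)) satisfies L'(x) ≥ −x − √(2/π); equivalently, the hazard rate φ(x)/Q(x) of the standard normal distribution satisfies φ(x)/Q(x) ≤ x + √(2/π) for x ≥ 0. -/

import Mathlib

open Real MeasureTheory

/-- The Gaussian Q-function: tail probability of a standard normal. -/
noncomputable def gaussQ (x : ℝ) : ℝ :=
  (1 / Real.sqrt (2 * Real.pi)) * ∫ u in Set.Ioi x, Real.exp (-u ^ 2 / 2)

/-- The standard normal density. -/
noncomputable def gaussPhi (x : ℝ) : ℝ :=
  Real.exp (-x ^ 2 / 2) / Real.sqrt (2 * Real.pi)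

lemma aux_int : Integrable (fun u : ℝ => Real.exp (-u ^ 2 / 2)) := by
  have h := integrable_exp_neg_mul_sq (b := 1/2) (by norm_num)
  refine h.congr (Filter.Eventually.of_forall fun u => ?_)
  simp only
  congr 1
  ring

lemma aux_J0 : ∫ u in Set.Ioi (0:ℝ), Real.exp (-u ^ 2 / 2) = Real.sqrt (Real.pi / 2) := by
  have h := integral_gaussian_Ioi (1/2)
  have e : (fun u : ℝ => Real.exp (-u ^ 2 / 2)) = fun u : ℝ => Real.exp (-(1/2) * u ^ 2) := by
    funext u
    congr 1
    ring
  rw [e, h]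
  have : Real.pi / (1/2) = 2 ^ 2 * (Real.pi / 2) := by ring
  rw [this, Real.sqrt_mul (by positivity), Real.sqrt_sq (by norm_num)]
  ring

lemma aux_split (x : ℝ) : ∫ u in Set.Ioi x, Real.exp (-u ^ 2 / 2) =
    (∫ u in Set.Ioi (0:ℝ), Real.exp (-u ^ 2 / 2)) - ∫ u in (0:ℝ)..x, Real.exp (-u ^ 2 / 2) := by
  have := intervalIntegral.integral_interval_add_Ioi (a := 0) (b := x)
    aux_int.integrableOn aux_int.integrableOn
  linarith

lemma aux_deriv (x : ℝ) : HasDerivAt (fun y : ℝ => ∫ u in Set.Ioi y, Real.exp (-u ^ 2 / 2))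
    (-Real.exp (-x ^ 2 / 2)) x := by
  have hc : Continuous (fun u : ℝ => Real.exp (-u ^ 2 / 2)) := by fun_prop
  have h := (hc.integral_hasStrictDerivAt 0 x).hasDerivAt.const_sub
    (∫ u in Set.Ioi (0:ℝ), Real.exp (-u ^ 2 / 2))
  exact h.congr_of_eventuallyEq (Filter.Eventually.of_forall aux_split)

lemma aux_tendsto : Filter.Tendsto (fun y : ℝ => ∫ u in Set.Ioi y, Real.exp (-u ^ 2 / 2))
    Filter.atTop (nhds 0) := by
  have h := (intervalIntegral_tendsto_integral_Ioi (0:ℝ) aux_int.integrableOn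
    Filter.tendsto_id).const_sub (∫ u in Set.Ioi (0:ℝ), Real.exp (-u ^ 2 / 2))
  rw [sub_self] at h
  exact h.congr (fun y => (aux_split y).symm)

lemma aux_main (x : ℝ) (hx : 0 ≤ x) : Real.exp (-x ^ 2 / 2) / (x + Real.sqrt (2 / Real.pi)) ≤
    ∫ u in Set.Ioi x, Real.exp (-u ^ 2 / 2) := by
  set c := Real.sqrt (2 / Real.pi) with hc
  have hcpos : 0 < c := by positivity
  have hc2 : c ^ 2 = 2 / Real.pi := Real.sq_sqrt (by positivity)
  have hc1 : c ^ 2 ≤ 1 := by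
    rw [hc2, div_le_one Real.pi_pos]
    linarith [Real.pi_gt_three]
  set G : ℝ → ℝ := fun y => (∫ u in Set.Ioi y, Real.exp (-u ^ 2 / 2)) -
    Real.exp (-y ^ 2 / 2) / (y + c) with hG
  have hd : ∀ y, 0 ≤ y → HasDerivAt G (Real.exp (-y ^ 2 / 2) / (y + c) ^ 2 *
      (1 - c * y - c ^ 2)) y := by
    intro y hy
    have hne : y + c ≠ 0 := by positivity
    have h1 : HasDerivAt (fun y : ℝ => Real.exp (-y ^ 2 / 2))
        (Real.exp (-y ^ 2 / 2) * (-y)) y := by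
      have h0 : HasDerivAt (fun y : ℝ => -y ^ 2 / 2) (-y) y :=
        ((hasDerivAt_pow 2 y).neg.div_const 2).congr_deriv (by norm_num; ring)
      exact h0.exp
    have h2 := (aux_deriv y).sub (h1.div ((hasDerivAt_id y).add_const c) hne)
    refine HasDerivAt.congr_deriv (f := G) h2 ?_
    simp only [id]
    field_simp
    ring
  have hcont : ∀ s : Set ℝ, s ⊆ Set.Ici 0 → ContinuousOn G s := fun s hs y hy =>
    (hd y (hs hy)).continuousAt.continuousWithinAt
  set x0 := (1 - c ^ 2) / c with hx0
  have hx0n : 0 ≤ x0 := div_nonneg (by linarith) hcpos.le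
  have hcx : c * x0 = 1 - c ^ 2 := by
    rw [hx0]
    field_simp
  have hG0 : G 0 = 0 := by
    simp only [hG]
    rw [aux_J0]
    have : Real.sqrt (Real.pi / 2) = c⁻¹ := by
      rw [hc, ← Real.sqrt_inv, inv_div]
    rw [this]
    simp
  suffices 0 ≤ G x by
    simp only [hG] at this
    linarith
  rcases le_total x x0 with h | h
  · have hm : MonotoneOn G (Set.Icc 0 x0) := by
      apply monotoneOn_of_deriv_nonneg (convex_Icc _ _) (hcont _ fun y hy => hy.1)
      · intro y hy
        rw [interior_Icc] at hy
        exact (hd y hy.1.le).differentiableAt.differentiableWithinAt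
      · intro y hy
        rw [interior_Icc] at hy
        rw [(hd y hy.1.le).deriv]
        have := mul_le_mul_of_nonneg_left hy.2.le hcpos.le
        exact mul_nonneg (by positivity) (by linarith)
    rw [← hG0]
    exact hm ⟨le_rfl, hx0n⟩ ⟨hx, h⟩ hx
  · have hm : AntitoneOn G (Set.Ici x0) := by
      apply antitoneOn_of_deriv_nonpos (convex_Ici _) (hcont _ fun y hy => hx0n.trans hy)
      · intro y hy
        rw [interior_Ici] at hy
        exact (hd y (hx0n.trans hy.le)).differentiableAt.differentiableWithinAt
      · intro y hy
        rw [interior_Ici] at hy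
        rw [(hd y (hx0n.trans hy.le)).deriv]
        have := mul_le_mul_of_nonneg_left (le_of_lt hy) hcpos.le
        exact mul_nonpos_of_nonneg_of_nonpos (by positivity) (by linarith)
    have ht : Filter.Tendsto G Filter.atTop (nhds 0) := by
      have h2 : Filter.Tendsto (fun y : ℝ => Real.exp (-y ^ 2 / 2) / (y + c))
          Filter.atTop (nhds 0) := by
        have h3 : Filter.Tendsto (fun y : ℝ => (y + c)⁻¹) Filter.atTop (nhds 0) :=
          tendsto_inv_atTop_zero.comp (Filter.tendsto_atTop_add_const_right _ c Filter.tendsto_id)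
        refine squeeze_zero' ?_ ?_ h3
        · filter_upwards [Filter.eventually_ge_atTop 0] with y hy
          positivity
        · filter_upwards [Filter.eventually_ge_atTop 0] with y hy
          rw [div_eq_mul_inv]
          have : Real.exp (-y ^ 2 / 2) ≤ 1 := Real.exp_le_one_iff.2 (by nlinarith [sq_nonneg y])
          exact mul_le_of_le_one_left (by positivity) this
      simpa using aux_tendsto.sub h2
    refine le_of_tendsto ht ?_
    filter_upwards [Filter.eventually_ge_atTop x] with y hy
    exact hm h (h.trans hy) hy

theorem deriv_log_gaussQ_ge (x : ℝ) (hx : 0 ≤ x) :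
    deriv (fun y : ℝ => Real.log (gaussQ y)) x ≥ -x - Real.sqrt (2 / Real.pi) ∧
    gaussPhi x / gaussQ x ≤ x + Real.sqrt (2 / Real.pi) := by
  have hm := aux_main x hx
  have hc : 0 < x + Real.sqrt (2 / Real.pi) := by positivity
  have hJ : 0 < ∫ u in Set.Ioi x, Real.exp (-u ^ 2 / 2) :=
    lt_of_lt_of_le (by positivity) hm
  have hQ : 0 < gaussQ x := by
    unfold gaussQ
    positivity
  have h2 : gaussPhi x / gaussQ x ≤ x + Real.sqrt (2 / Real.pi) := by
    rw [div_le_iff₀ hQ]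
    rw [div_le_iff₀ hc] at hm
    unfold gaussPhi gaussQ
    have := mul_le_mul_of_nonneg_left hm (a := 1 / Real.sqrt (2 * Real.pi)) (by positivity)
    calc _ = 1 / Real.sqrt (2 * Real.pi) * Real.exp (-x ^ 2 / 2) := by ring
      _ ≤ _ := this
      _ = _ := by ring
  refine ⟨?_, h2⟩
  have hd : HasDerivAt gaussQ (-gaussPhi x) x := by
    have := (aux_deriv x).const_mul (1 / Real.sqrt (2 * Real.pi))
    refine HasDerivAt.congr_deriv (f := gaussQ) this ?_
    unfold gaussPhi
    ring
  rw [(hd.log hQ.ne').deriv, neg_div]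
  linarith
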